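/- Let G be a natural unit interval graph with independence number α(G) = 2. Then X_G(x) is e-positive; that is, every coefficient c_λ in the expansion X_G(x) = Σ_λ c_λ e_λ is nonnegative. -/

import Mathlib

open Finset MvPolynomial
open scoped Classical

noncomputable section

/-- `κ` is a proper colouring of `G`. -/
def IsProper {n N : ℕ} (G : SimpleGraph (Fin n)) (κ : Fin n → Fin N) : Prop :=
  ∀ i j, G.Adj i j → κ i ≠ κ j

/-- The chromatic symmetric function of `G`, truncated to `N` variables. -/
def chromSym (n N : ℕ) (G : SimpleGraph (Fin n)) : MvPolynomial (Fin N) ℤ :=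
  ∑ κ : Fin n → Fin N, if IsProper G κ then ∏ i, X (κ i) else 0

/-- The number of ascents of a colouring. -/
def ascNum {n N : ℕ} (G : SimpleGraph (Fin n)) (κ : Fin n → Fin N) : ℕ :=
  ((Finset.univ : Finset (Fin n × Fin n)).filter fun p =>
    G.Adj p.1 p.2 ∧ p.1 < p.2 ∧ κ p.1 < κ p.2).card

/-- The chromatic quasisymmetric function of `G`, with coefficients in `ℤ[q]`,
truncated to `N` variables. -/
def chromQSym (n N : ℕ) (G : SimpleGraph (Fin n)) :
    MvPolynomial (Fin N) (Polynomial ℤ) :=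
  ∑ κ : Fin n → Fin N, if IsProper G κ then
    C (Polynomial.X ^ ascNum G κ) * ∏ i, X (κ i) else 0

/-- `e_λ`, the product of elementary symmetric polynomials over the parts of `λ`. -/
def eProd (N : ℕ) (R : Type) [CommSemiring R] {n : ℕ} (p : Nat.Partition n) :
    MvPolynomial (Fin N) R :=
  (p.parts.map fun k => esymm (Fin N) R k).prod

/-- The number of parts of a partition, i.e. `λ'_1`. -/
def numParts {n : ℕ} (p : Nat.Partition n) : ℕ := Multiset.card p.parts

/-- The largest part `λ_1` of a partition. -/
def maxPart {n : ℕ} (p : Nat.Partition n) : ℕ := p.parts.sup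

/-- `λ'_1 + ⋯ + λ'_k`, the number of cells in the first `k` columns of `λ`. -/
def conjSum {n : ℕ} (p : Nat.Partition n) (k : ℕ) : ℕ :=
  (p.parts.map fun a => min a k).sum

/-- `λ_1 + ⋯ + λ_k`, the number of cells in the first `k` rows of `λ`. -/
def partSum {n : ℕ} (p : Nat.Partition n) (k : ℕ) : ℕ :=
  ∑ j ∈ Finset.Icc 1 n, min (Multiset.card (p.parts.filter fun a => j ≤ a)) k

/-- `s` is an independent set of vertices of `G`. -/
def IsIndepFinset {V : Type} (G : SimpleGraph V) (s : Finset V) : Prop :=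
  ∀ i ∈ s, ∀ j ∈ s, ¬ G.Adj i j

/-- `s` is a clique of `G`. -/
def IsCliqueFinset {V : Type} (G : SimpleGraph V) (s : Finset V) : Prop :=
  ∀ i ∈ s, ∀ j ∈ s, i ≠ j → G.Adj i j

/-- The independence number `α(G)`. -/
def indepNum {n : ℕ} (G : SimpleGraph (Fin n)) : ℕ :=
  sSup {k | ∃ s : Finset (Fin n), IsIndepFinset G s ∧ s.card = k}

/-- The clique number `ω(G)`. -/
def cliqueNum {n : ℕ} (G : SimpleGraph (Fin n)) : ℕ :=
  sSup {k | ∃ s : Finset (Fin n), IsCliqueFinset G s ∧ s.card = k}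

/-- `α_k(G)`: the maximum number of vertices in an independent partition
with `k` blocks. -/
def alphaK {n : ℕ} (G : SimpleGraph (Fin n)) (k : ℕ) : ℕ :=
  sSup {m | ∃ B : Fin k → Finset (Fin n),
    (∀ i j, i ≠ j → Disjoint (B i) (B j)) ∧
    (∀ i, IsIndepFinset G (B i)) ∧ m = ∑ i, (B i).card}

/-- `ω_k(G)`: the maximum number of vertices in a clique partition
with `k` blocks. -/
def omegaK {n : ℕ} (G : SimpleGraph (Fin n)) (k : ℕ) : ℕ :=
  sSup {m | ∃ B : Fin k → Finset (Fin n),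
    (∀ i j, i ≠ j → Disjoint (B i) (B j)) ∧
    (∀ i, IsCliqueFinset G (B i)) ∧ m = ∑ i, (B i).card}

/-- `G` is a natural unit interval graph. -/
def IsNUIG {n : ℕ} (G : SimpleGraph (Fin n)) : Prop :=
  ∀ i j k : Fin n, i < j → j < k → G.Adj i k → G.Adj i j ∧ G.Adj j k

/-- The `q`-integer `[k]_q = 1 + q + ⋯ + q^(k-1)` in `ℤ[q]`. -/
def qInt (k : ℕ) : Polynomial ℤ := ∑ i ∈ Finset.range k, Polynomial.X ^ i

/-- The `q`-factorial `[k]_q!` in `ℤ[q]`. -/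
def qFact : ℕ → Polynomial ℤ
  | 0 => 1
  | k + 1 => qInt (k + 1) * qFact k

end

/-- Inverse factorial of `x - j`, zero when `j > x`. -/
noncomputable def invf (x j : ℕ) : ℚ := if j ≤ x then 1 / ((x - j).factorial : ℚ) else 0

/-- The weight attached to monomials with `j` squares. -/
noncomputable def wt (n i a j : ℕ) : ℚ := ((n - 2 * j).factorial : ℚ) * invf i j * invf a j

lemma wt_zero_rec (n a j : ℕ) : wt n 0 a j = ((a : ℚ) + 1) * wt n 0 (a + 1) j := by
  unfold wt invf
  rcases Nat.eq_zero_or_pos j with rfl | hj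
  · simp [Nat.factorial_succ]
    have : ((a : ℚ) + 1) ≠ 0 := by positivity
    field_simp
  · have : ¬ j ≤ 0 := by omega
    simp [this]

lemma wt_succ_rec (n i a j : ℕ) (h : i + 1 ≤ a) :
    wt n (i + 1) a j = ((a : ℚ) - i) * wt n (i + 1) (a + 1) j + wt n i (a + 1) j := by
  unfold wt invf
  rcases Nat.lt_trichotomy j (i + 1) with hj | hj | hj
  · obtain ⟨x, rfl⟩ := Nat.exists_eq_add_of_le (show j ≤ i by omega)
    obtain ⟨d, rfl⟩ := Nat.exists_eq_add_of_le h
    have e1 : j + x + 1 - j = x + 1 := by omega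
    have e2 : j + x + 1 + d - j = x + d + 1 := by omega
    have e3 : j + x + 1 + d + 1 - j = x + d + 2 := by omega
    have e4 : j + x - j = x := by omega
    rw [if_pos (by omega), if_pos (by omega), if_pos (by omega), if_pos (by omega), e1, e2, e3, e4]
    simp only [Nat.factorial_succ]
    push_cast
    have h1 := Nat.factorial_ne_zero x
    have h2 := Nat.factorial_ne_zero (x + d)
    have h1' : (x.factorial : ℚ) ≠ 0 := by exact_mod_cast h1
    have h2' : ((x + d).factorial : ℚ) ≠ 0 := by exact_mod_cast h2
    have h3 : (x : ℚ) + 1 ≠ 0 := by positivity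
    have h4 : (x : ℚ) + d + 1 ≠ 0 := by positivity
    have h5 : (x : ℚ) + d + 1 + 1 ≠ 0 := by positivity
    field_simp
    ring
  · subst hj
    obtain ⟨d, rfl⟩ := Nat.exists_eq_add_of_le h
    have e2 : i + 1 + d - (i + 1) = d := by omega
    have e3 : i + 1 + d + 1 - (i + 1) = d + 1 := by omega
    rw [if_pos (by omega), if_pos (by omega), if_pos (by omega), if_neg (by omega), e2, e3]
    simp only [Nat.factorial_succ]
    push_cast
    have h2 := Nat.factorial_ne_zero d
    have h2' : (d.factorial : ℚ) ≠ 0 := by exact_mod_cast h2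
    have h3 : (d : ℚ) + 1 ≠ 0 := by positivity
    field_simp
    ring
  · have h1 : ¬ j ≤ i + 1 := by omega
    have h2 : ¬ j ≤ i := by omega
    simp [h1, h2]

/-- The index set of monomials with exponents at most two. -/
noncomputable def idx (N n : ℕ) : Finset (Finset (Fin N) × Finset (Fin N)) :=
  Finset.univ.filter fun p => Disjoint p.1 p.2 ∧ 2 * p.1.card + p.2.card = n

/-- The squarefree monomial of a set. -/
noncomputable def sm {N : ℕ} (S : Finset (Fin N)) : MvPolynomial (Fin N) ℚ := ∏ i ∈ S, X i

/-- The basic symmetric functions. -/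
noncomputable def Phi (N n i a : ℕ) : MvPolynomial (Fin N) ℚ :=
  ∑ p ∈ idx N n, C (wt n i a p.1.card) * (sm p.1 ^ 2 * sm p.2)

lemma Phi_zero_rec (N n a : ℕ) : Phi N n 0 a = C ((a : ℚ) + 1) * Phi N n 0 (a + 1) := by
  unfold Phi
  rw [Finset.mul_sum]
  refine Finset.sum_congr rfl fun p _ => ?_
  rw [wt_zero_rec, C_mul, mul_assoc]

lemma Phi_succ_rec (N n i a : ℕ) (h : i + 1 ≤ a) :
    Phi N n (i + 1) a = C ((a : ℚ) - i) * Phi N n (i + 1) (a + 1) + Phi N n i (a + 1) := by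
  unfold Phi
  rw [Finset.mul_sum, ← Finset.sum_add_distrib]
  refine Finset.sum_congr rfl fun p _ => ?_
  rw [wt_succ_rec _ _ _ _ h, C_add, C_mul]
  ring

lemma fiber_sum (N n a b : ℕ) (hab : a + b = n) (I U : Finset (Fin N)) (hIU : Disjoint I U)
    (hn : 2 * I.card + U.card = n) :
    (((((powersetCard a univ) ×ˢ (powersetCard b univ)).filter
      fun q : Finset (Fin N) × Finset (Fin N) => (q.1 ∩ q.2, symmDiff q.1 q.2) = (I, U)).card : ℕ) : ℚ)
      = wt n b a I.card := by
  by_cases hj : I.card ≤ a ∧ I.card ≤ b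
  · obtain ⟨ha, hb⟩ := hj
    have hcard : (((powersetCard a univ) ×ˢ (powersetCard b univ)).filter
      fun q : Finset (Fin N) × Finset (Fin N) => (q.1 ∩ q.2, symmDiff q.1 q.2) = (I, U)).card
        = (powersetCard (a - I.card) U).card := by
      refine Finset.card_bij' (fun q _ => q.1 \ q.2) (fun W _ => (I ∪ W, I ∪ (U \ W))) ?_ ?_ ?_ ?_
      · rintro ⟨S, T⟩ h
        simp only [mem_filter, mem_product, mem_powersetCard, subset_univ, true_and,
          Prod.mk.injEq] at h ⊢
        obtain ⟨⟨h1, h2⟩, rfl, rfl⟩ := h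
        refine ⟨fun x hx => ?_, ?_⟩
        · simp only [mem_sdiff] at hx
          simp [Finset.mem_symmDiff, hx.1, hx.2]
        · rw [card_sdiff, inter_comm, h1]
      · intro W h
        simp only [mem_filter, mem_product, mem_powersetCard, subset_univ, true_and,
          Prod.mk.injEq] at h ⊢
        obtain ⟨h1, h2⟩ := h
        refine ⟨⟨?_, ?_⟩, ?_, ?_⟩
        · rw [card_union_of_disjoint (hIU.mono_right h1)]; omega
        · rw [card_union_of_disjoint (hIU.mono_right sdiff_subset), card_sdiff_of_subset h1]; omega
        · ext x
          simp only [mem_inter, mem_union, mem_sdiff]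
          tauto
        · ext x
          have := @h1 x
          have h3 : x ∈ I → x ∉ U := fun h h' => (Finset.disjoint_left.1 hIU) h h'
          simp only [Finset.mem_symmDiff, mem_union, mem_sdiff]
          tauto
      · rintro ⟨S, T⟩ h
        simp only [mem_filter, mem_product, mem_powersetCard, subset_univ, true_and,
          Prod.mk.injEq] at h ⊢
        obtain ⟨⟨h1, h2⟩, rfl, rfl⟩ := h
        constructor
        · ext x
          simp only [mem_inter, mem_union, mem_sdiff]
          tauto
        · ext x
          simp only [mem_inter, mem_union, mem_sdiff, Finset.mem_symmDiff]
          tauto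
      · intro W h
        simp only [mem_powersetCard] at h
        ext x
        have := @h.1 x
        have h3 : x ∈ I → x ∉ U := fun h h' => (Finset.disjoint_left.1 hIU) h h'
        simp only [mem_union, mem_sdiff]
        tauto
    rw [hcard, card_powersetCard]
    unfold wt invf
    rw [if_pos ha, if_pos hb, Nat.cast_choose ℚ (by omega)]
    have e1 : U.card = n - 2 * I.card := by omega
    have e2 : U.card - (a - I.card) = b - I.card := by omega
    rw [e2, e1]
    field_simp
  · have h0 : wt n b a I.card = 0 := by
      unfold wt invf
      rcases not_and_or.1 hj with h | h <;> simp [h]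
    rw [h0, Nat.cast_eq_zero, card_eq_zero, filter_eq_empty_iff]
    rintro ⟨S, T⟩ h h'
    simp only [mem_product, mem_powersetCard, subset_univ, true_and, Prod.mk.injEq] at h h'
    apply hj
    rw [← h'.1, ← h.1, ← h.2]
    exact ⟨card_le_card inter_subset_left, card_le_card inter_subset_right⟩

lemma card_symmDiff_aux {N : ℕ} (S T : Finset (Fin N)) :
    2 * (S ∩ T).card + (symmDiff S T).card = S.card + T.card := by
  have h1 := card_sdiff_add_card_inter S T
  have h2 := card_sdiff_add_card_inter T S
  have h3 : (symmDiff S T).card = (S \ T).card + (T \ S).card := by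
    rw [symmDiff_def, sup_eq_union, card_union_of_disjoint disjoint_sdiff_sdiff]
  rw [inter_comm T S] at h2
  omega

lemma sm_mul {N : ℕ} (S T : Finset (Fin N)) :
    sm S * sm T = sm (S ∩ T) ^ 2 * sm (symmDiff S T) := by
  unfold sm
  rw [← prod_inter_mul_prod_sdiff S T, ← prod_inter_mul_prod_sdiff T S, symmDiff_def, sup_eq_union,
    prod_union disjoint_sdiff_sdiff, inter_comm T S]
  ring

lemma pair_sum (N n a b : ℕ) (hab : a + b = n) (f : ℕ → ℚ) :
    ∑ q ∈ (powersetCard a univ) ×ˢ (powersetCard b univ),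
      C (f (q.1 ∩ q.2).card) * (sm q.1 * sm q.2) =
    ∑ p ∈ idx N n, C (f p.1.card * wt n b a p.1.card) * (sm p.1 ^ 2 * sm p.2) := by
  rw [← Finset.sum_fiberwise_of_maps_to (t := idx N n)
    (g := fun q : Finset (Fin N) × Finset (Fin N) => (q.1 ∩ q.2, symmDiff q.1 q.2))]
  · refine Finset.sum_congr rfl ?_
    rintro ⟨I, U⟩ hp
    simp only [idx, mem_filter, mem_univ, true_and] at hp
    rw [← fiber_sum N n a b hab I U hp.1 hp.2]
    rw [Finset.sum_congr rfl (g := fun _ => C (f I.card) * (sm I ^ 2 * sm U))]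
    · rw [sum_const, nsmul_eq_mul, C_mul]
      simp only [map_natCast]
      ring
    · rintro ⟨S, T⟩ h
      simp only [mem_filter, Prod.mk.injEq] at h
      obtain ⟨_, rfl, rfl⟩ := h
      rw [← sm_mul]
  · rintro ⟨S, T⟩ h
    simp only [mem_product, mem_powersetCard, subset_univ, true_and] at h
    simp only [idx, mem_filter, mem_univ, true_and]
    refine ⟨?_, ?_⟩
    · rw [Finset.disjoint_left]
      intro x
      simp only [mem_inter, Finset.mem_symmDiff]
      tauto
    · rw [card_symmDiff_aux]; omega

lemma esymm_mul_eq_Phi (N n a b : ℕ) (hab : a + b = n) :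
    esymm (Fin N) ℚ a * esymm (Fin N) ℚ b = Phi N n b a := by
  have := pair_sum N n a b hab (fun _ => 1)
  simp only [C_1, one_mul] at this
  unfold Phi
  rw [← this, esymm, esymm, sum_mul_sum, sum_product]
  rfl

/-- `e`-positivity over the rationals. -/
def Epos (N n : ℕ) (P : MvPolynomial (Fin N) ℚ) : Prop :=
  ∃ c : Nat.Partition n → ℚ, (∀ p, 0 ≤ c p) ∧ P = ∑ p, C (c p) * eProd N ℚ p

lemma Epos.add {N n : ℕ} {P Q : MvPolynomial (Fin N) ℚ} (hP : Epos N n P) (hQ : Epos N n Q) :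
    Epos N n (P + Q) := by
  obtain ⟨c, hc, rfl⟩ := hP
  obtain ⟨d, hd, rfl⟩ := hQ
  refine ⟨fun p => c p + d p, fun p => add_nonneg (hc p) (hd p), ?_⟩
  rw [← Finset.sum_add_distrib]
  exact Finset.sum_congr rfl fun p _ => by rw [C_add, add_mul]

lemma Epos.zero (N n : ℕ) : Epos N n 0 := ⟨fun _ => 0, fun _ => le_rfl, by simp⟩

lemma Epos.smul {N n : ℕ} {P : MvPolynomial (Fin N) ℚ} (hP : Epos N n P) (r : ℚ) (hr : 0 ≤ r) :
    Epos N n (C r * P) := by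
  obtain ⟨c, hc, rfl⟩ := hP
  refine ⟨fun p => r * c p, fun p => mul_nonneg hr (hc p), ?_⟩
  rw [Finset.mul_sum]
  exact Finset.sum_congr rfl fun p _ => by rw [C_mul, mul_assoc]

lemma Epos.sum {N n : ℕ} {ι : Type*} (s : Finset ι) (P : ι → MvPolynomial (Fin N) ℚ)
    (hP : ∀ i ∈ s, Epos N n (P i)) : Epos N n (∑ i ∈ s, P i) := by
  induction s using Finset.induction_on with
  | empty => simpa using Epos.zero N n
  | insert i s hi ih =>
    rw [Finset.sum_insert hi]
    exact (hP i (by simp)).add (ih fun j hj => hP j (by simp [hj]))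

lemma Epos_esymm_mul (N n a b : ℕ) (hab : a + b = n) :
    Epos N n (esymm (Fin N) ℚ a * esymm (Fin N) ℚ b) := by
  let q : Nat.Partition n := Nat.Partition.ofSums n {a, b} (by simpa using hab)
  refine ⟨fun p => if p = q then 1 else 0, fun p => by dsimp only; split_ifs <;> simp, ?_⟩
  rw [Finset.sum_eq_single q]
  · simp only [if_true, C_1, one_mul, eProd, q, Nat.Partition.ofSums]
    by_cases ha : a = 0 <;> by_cases hb : b = 0 <;>
      simp [ha, hb, Multiset.filter_singleton]
  · intro p _ hp
    simp [hp]
  · simp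

lemma Epos_Phi (N n : ℕ) : ∀ D i a, i ≤ a → a + i + D = n → Epos N n (Phi N n i a) := by
  intro D
  induction D with
  | zero =>
    intro i a _ h
    rw [← esymm_mul_eq_Phi N n a i (by omega)]
    exact Epos_esymm_mul N n a i (by omega)
  | succ D ihD =>
    intro i
    induction i with
    | zero =>
      intro a _ h
      rw [Phi_zero_rec]
      exact (ihD 0 (a + 1) (by omega) (by omega)).smul _ (by positivity)
    | succ i ihi =>
      intro a hia h
      rw [Phi_succ_rec _ _ _ _ hia]
      refine ((ihD (i + 1) (a + 1) (by omega) (by omega)).smul _ ?_).add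
        (ihi (a + 1) (by omega) (by omega))
      have : (i : ℚ) + 1 ≤ a := by exact_mod_cast hia
      linarith

/-- Exponent vector of a partition. -/
noncomputable def pvec {n : ℕ} (p : Nat.Partition n) : Fin n →₀ ℕ :=
  Finsupp.equivFunOnFinite.symm fun i => p.parts.count ((i : ℕ) + 1)

lemma part_le {n : ℕ} (p : Nat.Partition n) {k : ℕ} (hk : k ∈ p.parts) : k ≤ n := by
  have := Multiset.le_sum_of_mem hk
  rwa [p.parts_sum] at this

lemma pvec_injective {n : ℕ} : Function.Injective (pvec (n := n)) := by
  intro p q h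
  apply Nat.Partition.ext
  apply Multiset.ext.2
  intro k
  by_cases hk : 1 ≤ k ∧ k ≤ n
  · have := DFunLike.congr_fun h (⟨k - 1, by omega⟩ : Fin n)
    simp only [pvec, Finsupp.equivFunOnFinite_symm_apply_apply] at this
    rwa [show k - 1 + 1 = k by omega] at this
  · have : ∀ r : Nat.Partition n, k ∉ r.parts := fun r hr =>
      hk ⟨r.parts_pos hr, part_le r hr⟩
    rw [Multiset.count_eq_zero_of_notMem (this p), Multiset.count_eq_zero_of_notMem (this q)]

lemma eProd_eq {n N : ℕ} (p : Nat.Partition n) (r : ℚ) :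
    C r * eProd N ℚ p = (esymmAlgHom (Fin N) ℚ n (monomial (pvec p) r)).val := by
  rw [esymmAlgHom_apply, aeval_monomial, algebraMap_eq]
  congr 1
  rw [Finsupp.prod_fintype _ _ (by simp), eProd, Finset.prod_multiset_map_count]
  simp only [pvec, Finsupp.equivFunOnFinite_symm_apply_apply]
  rw [Fin.prod_univ_eq_prod_range
    (fun i => esymm (Fin N) ℚ (i + 1) ^ Multiset.count (i + 1) p.parts) n,
    ← Finset.prod_image (s := range n) (g := fun i => i + 1)
      (f := fun m => esymm (Fin N) ℚ m ^ Multiset.count m p.parts) (by intro x _ y _ h; simpa using h)]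
  refine Finset.prod_subset ?_ ?_
  · intro k hk
    rw [Multiset.mem_toFinset] at hk
    have h1 := p.parts_pos hk
    have h2 := part_le p hk
    exact Finset.mem_image.2 ⟨k - 1, Finset.mem_range.2 (by omega), by omega⟩
  · intro k _ hk
    rw [Multiset.mem_toFinset] at hk
    rw [Multiset.count_eq_zero_of_notMem hk, pow_zero]

lemma eProd_indep {n N : ℕ} (hN : n ≤ N) (c d : Nat.Partition n → ℚ)
    (h : ∑ p, C (c p) * eProd N ℚ p = ∑ p, C (d p) * eProd N ℚ p) : c = d := by
  simp only [eProd_eq] at h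
  have h2 : esymmAlgHom (Fin N) ℚ n (∑ p, monomial (pvec p) (c p)) =
      esymmAlgHom (Fin N) ℚ n (∑ p, monomial (pvec p) (d p)) := by
    apply Subtype.ext
    simpa only [map_sum, AddSubmonoidClass.coe_finsetSum] using h
  have h3 := esymmAlgHom_fin_injective ℚ hN h2
  funext p
  have h4 := congrArg (coeff (pvec p)) h3
  simpa [coeff_sum, coeff_monomial, pvec_injective.eq_iff] using h4

/-- Counting injections with a constraint. -/
lemma count_emb {B : Type} [Fintype B] {γ : Type} [Fintype γ] (H : Finset B) (J : Finset γ)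
    (hc : Fintype.card B = Fintype.card γ) :
    Nat.card {f : B ↪ γ // ∀ v, f v ∈ J → v ∈ H} =
      (Fintype.card B - J.card).descFactorial (Fintype.card B - H.card) * H.card.factorial := by
  have e0 : {f : B ↪ γ // ∀ v, f v ∈ J → v ∈ H} ≃
      {f : ({v // v ∉ H} ⊕ {v // v ∈ H}) ↪ γ // ∀ v, f (Sum.inl v) ∉ J} := by
    refine Equiv.subtypeEquiv (Equiv.embeddingCongr
      ((Equiv.sumComm _ _).trans (Equiv.sumCompl (· ∈ H))).symm (Equiv.refl γ)) ?_
    intro f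
    constructor
    · intro h v hv
      exact v.2 (h v.1 (by simpa [Equiv.embeddingCongr] using hv))
    · intro h v hv
      by_contra hvH
      exact h ⟨v, hvH⟩ (by simpa [Equiv.embeddingCongr] using hv)
  have e1 : {f : ({v // v ∉ H} ⊕ {v // v ∈ H}) ↪ γ // ∀ v, f (Sum.inl v) ∉ J} ≃
      {s : (Σ f : {v // v ∉ H} ↪ γ, {v // v ∈ H} ↪ ↥(Set.range f)ᶜ) // ∀ v, s.1 v ∉ J} := by
    refine Equiv.subtypeEquiv Equiv.sumEmbeddingEquivSigmaEmbeddingRestricted ?_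
    intro f
    rfl
  have e2 : {s : (Σ f : {v // v ∉ H} ↪ γ, {v // v ∈ H} ↪ ↥(Set.range f)ᶜ) // ∀ v, s.1 v ∉ J} ≃
      Σ f : {f : {v // v ∉ H} ↪ γ // ∀ v, f v ∉ J}, ({v // v ∈ H} ↪ ↥(Set.range f.1)ᶜ) :=
    Equiv.subtypeSigmaEquiv (fun f : {v // v ∉ H} ↪ γ => {v // v ∈ H} ↪ ↥(Set.range f)ᶜ)
      (fun f => ∀ v, f v ∉ J)
  have e3 : {f : {v // v ∉ H} ↪ γ // ∀ v, f v ∉ J} ≃ ({v // v ∉ H} ↪ {t // t ∉ J}) :=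
    ⟨fun f => ⟨fun v => ⟨f.1 v, f.2 v⟩, fun v w h => f.1.injective (congrArg Subtype.val h)⟩,
      fun f => ⟨f.trans (Function.Embedding.subtype _), fun v => (f v).2⟩,
      fun f => rfl, fun f => rfl⟩
  have hH : H.card ≤ Fintype.card B := card_le_univ H
  have cH : Fintype.card {v // v ∉ H} = Fintype.card B - H.card := by
    rw [Fintype.card_subtype_compl, Fintype.card_coe]
  have cJ : Fintype.card {t // t ∉ J} = Fintype.card B - J.card := by
    rw [Fintype.card_subtype_compl, Fintype.card_coe, hc]
  have c3 : Nat.card {f : {v // v ∉ H} ↪ γ // ∀ v, f v ∉ J} =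
      (Fintype.card B - J.card).descFactorial (Fintype.card B - H.card) := by
    rw [Nat.card_congr e3, Nat.card_eq_fintype_card, Fintype.card_embedding_eq, cH, cJ]
  have c4 : ∀ f : {v // v ∉ H} ↪ γ,
      Nat.card ({v // v ∈ H} ↪ ↥(Set.range f)ᶜ) = H.card.factorial := by
    intro f
    have : Fintype.card ↥(Set.range f)ᶜ = H.card := by
      rw [Fintype.card_compl_set, ← hc, Set.card_range_of_injective f.injective, cH]
      omega
    rw [Nat.card_eq_fintype_card, Fintype.card_embedding_eq, this, Fintype.card_coe,
      Nat.descFactorial_self]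
  rw [Nat.card_congr (e0.trans (e1.trans e2)), Nat.card_sigma]
  simp only [c4, Finset.sum_const, Finset.card_univ, smul_eq_mul, ← Nat.card_eq_fintype_card, c3]

lemma count_beta {B : Type} [Fintype B] {N : ℕ} (H : Finset B) (S T : Finset (Fin N))
    (hT : T.card = Fintype.card B) :
    (((Finset.univ.filter fun β : B → Fin N => Function.Injective β ∧ Finset.univ.image β = T ∧
      ∀ v, β v ∈ S → v ∈ H).card : ℕ) : ℚ) =
      (H.card.factorial : ℚ) * ((Fintype.card B - (S ∩ T).card).factorial : ℚ)
        * invf H.card (S ∩ T).card := by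
  have h1 : (Finset.univ.filter fun β : B → Fin N => Function.Injective β ∧
      Finset.univ.image β = T ∧ ∀ v, β v ∈ S → v ∈ H).card =
      Nat.card {f : B ↪ T // ∀ v, f v ∈ (S.subtype (· ∈ T)) → v ∈ H} := by
    rw [← Fintype.card_coe, ← Nat.card_eq_fintype_card]
    refine Nat.card_congr ⟨fun β => ⟨⟨fun v => ⟨β.1 v, ?_⟩, ?_⟩, ?_⟩,
      fun f => ⟨fun v => (f.1 v).1, ?_⟩, fun β => rfl, fun f => rfl⟩
    · have := (Finset.mem_filter.1 β.2).2.2.1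
      exact this.subset (Finset.mem_image_of_mem _ (Finset.mem_univ _))
    · intro v w h
      exact (Finset.mem_filter.1 β.2).2.1 (congrArg Subtype.val h)
    · intro v h
      rw [Finset.mem_subtype] at h
      exact (Finset.mem_filter.1 β.2).2.2.2 v h
    · have hinj : Function.Injective (fun v => ((f.1 v).1 : Fin N)) := fun v w h =>
        f.1.injective (Subtype.ext h)
      refine Finset.mem_filter.2 ⟨Finset.mem_univ _, hinj, ?_, fun v hv => f.2 v (by simpa using hv)⟩
      apply Finset.eq_of_subset_of_card_le
      · intro x hx
        obtain ⟨v, _, rfl⟩ := Finset.mem_image.1 hx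
        exact (f.1 v).2
      · rw [Finset.card_image_of_injective _ hinj, hT, Finset.card_univ]
  have h2 : (S.subtype (· ∈ T)).card = (S ∩ T).card := by
    rw [Finset.card_subtype, Finset.filter_mem_eq_inter]
  rw [h1, count_emb _ _ (by rw [Fintype.card_coe, hT]), h2]
  have hj : (S ∩ T).card ≤ Fintype.card B := hT ▸ card_le_card inter_subset_right
  have hH : H.card ≤ Fintype.card B := card_le_univ H
  unfold invf
  split_ifs with h
  · rw [Nat.descFactorial_eq_div (by omega), Nat.cast_mul,
      Nat.cast_div (Nat.factorial_dvd_factorial (by omega)) (by positivity),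
      show Fintype.card B - (S ∩ T).card - (Fintype.card B - H.card) = H.card - (S ∩ T).card by omega]
    ring
  · rw [Nat.descFactorial_of_lt (by omega)]
    simp

lemma count_alpha {A B : Type} [Fintype A] [Fintype B] {N : ℕ} (E : B → A → Prop) (g : B ↪ A)
    (β : B → Fin N) (hβ : Function.Injective β) (S : Finset (Fin N))
    (hS : S.card = Fintype.card A) :
    (Finset.univ.filter fun α : A → Fin N => Function.Injective α ∧ Finset.univ.image α = S ∧
      ∀ u v, α u = β v → E v u).card =
    (Finset.univ.filter fun σ : Equiv.Perm A => ∀ v, β v ∈ S → E v (σ (g v))).card := by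
  classical
  obtain ⟨γ, hγ⟩ : ∃ γ : A ≃ S, ∀ v, β v ∈ S → (γ (g v) : Fin N) = β v := by
    by_cases hB : Nonempty B
    · obtain ⟨γ, hγ⟩ := Finset.exists_equiv_extend_of_card_eq (α := A) (t := S) hS.symm
        (s := (Finset.univ.filter fun v => β v ∈ S).map g) (f := fun u => β (Function.invFun g u))
        (by
          intro x hx
          simp only [mem_image, mem_map, mem_filter, mem_univ, true_and] at hx
          obtain ⟨_, ⟨v, hv, rfl⟩, rfl⟩ := hx
          rwa [Function.leftInverse_invFun g.injective v])
        (by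
          intro x hx y hy hxy
          simp only [coe_map, coe_filter, mem_univ, true_and, Set.mem_image, Set.mem_ofPred_eq]
            at hx hy
          obtain ⟨v, hv, rfl⟩ := hx
          obtain ⟨w, hw, rfl⟩ := hy
          simp only [Function.leftInverse_invFun g.injective v,
            Function.leftInverse_invFun g.injective w] at hxy
          rw [hβ hxy])
      refine ⟨γ, fun v hv => ?_⟩
      rw [hγ (g v) (by simpa using hv), Function.leftInverse_invFun g.injective v]
    · exact ⟨Fintype.equivOfCardEq (by rw [Fintype.card_coe, hS]),
        fun v => (hB ⟨v⟩).elim⟩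
  symm
  refine Finset.card_bij (fun σ _ => fun u => ((γ (σ.symm u) : S) : Fin N)) ?_ ?_ ?_
  · intro σ hσ
    simp only [mem_filter, mem_univ, true_and] at hσ ⊢
    have hinj : Function.Injective fun u => ((γ (σ.symm u) : S) : Fin N) := fun u w h =>
      σ.symm.injective (γ.injective (Subtype.ext h))
    refine ⟨hinj, ?_, ?_⟩
    · apply Finset.eq_of_subset_of_card_le
      · intro x hx
        obtain ⟨v, _, rfl⟩ := Finset.mem_image.1 hx
        exact (γ (σ.symm v)).2
      · rw [Finset.card_image_of_injective _ hinj, hS, Finset.card_univ]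
    · intro u v huv
      have hvS : β v ∈ S := huv ▸ (γ (σ.symm u)).2
      have h1 := hγ v hvS
      have h2 : σ.symm u = g v := γ.injective (Subtype.ext (huv.trans h1.symm))
      have := hσ v hvS
      rwa [← h2, Equiv.apply_symm_apply] at this
  · intro σ _ τ _ h
    have : σ.symm = τ.symm := by
      ext u
      exact γ.injective (Subtype.ext (congrFun h u))
    simpa using congrArg Equiv.symm this
  · intro α hα
    simp only [mem_filter, mem_univ, true_and] at hα
    obtain ⟨hinj, himg, hE⟩ := hα
    have hmem : ∀ u, α u ∈ S := fun u => himg ▸ Finset.mem_image_of_mem _ (Finset.mem_univ _)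
    let τ : A → A := fun u => γ.symm ⟨α u, hmem u⟩
    have hτ : Function.Injective τ := fun u w h =>
      hinj (congrArg Subtype.val (γ.symm.injective h))
    let e : Equiv.Perm A := Equiv.ofBijective τ (Finite.injective_iff_bijective.1 hτ)
    have he : ∀ u, ((γ (e u) : S) : Fin N) = α u := fun u => by simp [e, τ]
    refine ⟨e.symm, ?_, ?_⟩
    · simp only [mem_filter, mem_univ, true_and]
      intro v hv
      apply hE
      rw [← he, Equiv.apply_symm_apply, hγ v hv]
    · funext u
      simp [he]

lemma wt_combine (n a b i j : ℕ) (hib : i ≤ b) :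
    (i.factorial : ℚ) * ((b - j).factorial : ℚ) * invf i j * wt n b a j =
      (i.factorial : ℚ) * wt n i a j := by
  unfold wt
  by_cases hj : j ≤ b
  · have : ((b - j).factorial : ℚ) * invf b j = 1 := by
      unfold invf
      rw [if_pos hj]
      have := Nat.factorial_ne_zero (b - j)
      field_simp
    linear_combination ((i.factorial : ℚ) * invf i j * ((n - 2 * j).factorial : ℚ) * invf a j) * this
  · have h1 : invf i j = 0 := if_neg (by omega)
    simp [h1]

lemma count_pair {A B : Type} [Fintype A] [Fintype B] {N : ℕ} (E : B → A → Prop) (g : B ↪ A)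
    (S T : Finset (Fin N)) (hS : S.card = Fintype.card A) (hT : T.card = Fintype.card B) :
    (((Finset.univ.filter fun κ : (A → Fin N) × (B → Fin N) =>
      (Function.Injective κ.1 ∧ Function.Injective κ.2 ∧ ∀ u v, κ.1 u = κ.2 v → E v u) ∧
      (Finset.univ.image κ.1, Finset.univ.image κ.2) = (S, T)).card : ℕ) : ℚ) =
    ∑ σ : Equiv.Perm A, (((Finset.univ.filter fun v => E v (σ (g v))).card.factorial : ℚ) *
      ((Fintype.card B - (S ∩ T).card).factorial : ℚ) *
        invf (Finset.univ.filter fun v => E v (σ (g v))).card (S ∩ T).card) := by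
  have h1 : (Finset.univ.filter fun κ : (A → Fin N) × (B → Fin N) =>
      (Function.Injective κ.1 ∧ Function.Injective κ.2 ∧ ∀ u v, κ.1 u = κ.2 v → E v u) ∧
      (Finset.univ.image κ.1, Finset.univ.image κ.2) = (S, T)).card =
      ∑ β : B → Fin N, if Function.Injective β ∧ Finset.univ.image β = T then
        (Finset.univ.filter fun σ : Equiv.Perm A => ∀ v, β v ∈ S → E v (σ (g v))).card else 0 := by
    rw [Finset.card_filter, Fintype.sum_prod_type_right]
    refine Finset.sum_congr rfl fun β _ => ?_
    split_ifs with h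
    · rw [← count_alpha E g β h.1 S hS, Finset.card_filter]
      refine Finset.sum_congr rfl fun α _ => ?_
      refine if_congr ?_ rfl rfl
      simp only [Prod.mk.injEq]
      tauto
    · refine Finset.sum_eq_zero fun α _ => if_neg ?_
      simp only [Prod.mk.injEq]
      tauto
  rw [h1]
  have h2 : ∀ β : B → Fin N, (if Function.Injective β ∧ Finset.univ.image β = T then
        (Finset.univ.filter fun σ : Equiv.Perm A => ∀ v, β v ∈ S → E v (σ (g v))).card else 0) =
      ∑ σ : Equiv.Perm A, if (Function.Injective β ∧ Finset.univ.image β = T ∧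
        ∀ v, β v ∈ S → v ∈ Finset.univ.filter fun v => E v (σ (g v))) then 1 else 0 := by
    intro β
    split_ifs with h
    · rw [Finset.card_filter]
      refine Finset.sum_congr rfl fun σ _ => ?_
      refine if_congr ?_ rfl rfl
      simp only [mem_filter, mem_univ, true_and]
      tauto
    · symm
      refine Finset.sum_eq_zero fun σ _ => if_neg ?_
      tauto
  rw [Finset.sum_congr rfl fun β _ => h2 β, Finset.sum_comm, Nat.cast_sum]
  refine Finset.sum_congr rfl fun σ _ => ?_
  rw [← count_beta _ S T hT, Finset.card_filter]

lemma two_clique_sum {A B : Type} [Fintype A] [Fintype B] {N n : ℕ} (E : B → A → Prop) (g : B ↪ A)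
    (hn : Fintype.card A + Fintype.card B = n) :
    (∑ κ : (A → Fin N) × (B → Fin N),
      if (Function.Injective κ.1 ∧ Function.Injective κ.2 ∧ ∀ u v, κ.1 u = κ.2 v → E v u) then
        (∏ u, X (κ.1 u)) * (∏ v, X (κ.2 v)) else (0 : MvPolynomial (Fin N) ℚ)) =
    ∑ σ : Equiv.Perm A, C ((Finset.univ.filter fun v => E v (σ (g v))).card.factorial : ℚ) *
      Phi N n (Finset.univ.filter fun v => E v (σ (g v))).card (Fintype.card A) := by
  rw [← Finset.sum_filter]
  rw [← Finset.sum_fiberwise_of_maps_to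
    (t := (powersetCard (Fintype.card A) univ) ×ˢ (powersetCard (Fintype.card B) univ))
    (g := fun κ : (A → Fin N) × (B → Fin N) => (Finset.univ.image κ.1, Finset.univ.image κ.2))]
  · have h1 : ∀ q ∈ (powersetCard (Fintype.card A) (univ : Finset (Fin N))) ×ˢ
          (powersetCard (Fintype.card B) (univ : Finset (Fin N))),
        (∑ κ ∈ (Finset.univ.filter fun κ : (A → Fin N) × (B → Fin N) =>
          (Function.Injective κ.1 ∧ Function.Injective κ.2 ∧ ∀ u v, κ.1 u = κ.2 v → E v u)).filter
          (fun κ => (Finset.univ.image κ.1, Finset.univ.image κ.2) = q),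
          (∏ u, X (κ.1 u)) * (∏ v, X (κ.2 v)) : MvPolynomial (Fin N) ℚ) =
        ∑ σ : Equiv.Perm A, C ((((Finset.univ.filter fun v => E v (σ (g v))).card.factorial : ℚ) *
          ((Fintype.card B - (q.1 ∩ q.2).card).factorial : ℚ) *
          invf (Finset.univ.filter fun v => E v (σ (g v))).card (q.1 ∩ q.2).card)) *
            (sm q.1 * sm q.2) := by
      rintro ⟨S, T⟩ hq
      simp only [mem_product, mem_powersetCard, subset_univ, true_and] at hq
      rw [← Finset.sum_mul, ← map_sum, ← count_pair E g S T hq.1 hq.2, Finset.filter_filter,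
        Finset.sum_congr rfl (g := fun _ => sm S * sm T)]
      · rw [sum_const, nsmul_eq_mul]
        simp only [map_natCast]
      · rintro ⟨α, β⟩ h
        simp only [mem_filter, mem_univ, true_and, Prod.mk.injEq] at h
        obtain ⟨⟨ha, hb, _⟩, rfl, rfl⟩ := h
        unfold sm
        rw [Finset.prod_image (fun x _ y _ h => ha h), Finset.prod_image (fun x _ y _ h => hb h)]
    rw [Finset.sum_congr rfl h1, Finset.sum_comm]
    refine Finset.sum_congr rfl fun σ _ => ?_
    set i := (Finset.univ.filter fun v => E v (σ (g v))).card with hi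
    have hib : i ≤ Fintype.card B := card_le_univ _
    rw [pair_sum N n _ _ hn (fun j => (i.factorial : ℚ) *
          ((Fintype.card B - j).factorial : ℚ) * invf i j)]
    unfold Phi
    rw [Finset.mul_sum]
    refine Finset.sum_congr rfl fun p _ => ?_
    rw [wt_combine _ _ _ _ _ hib, C_mul, mul_assoc]
  · rintro ⟨α, β⟩ h
    simp only [mem_filter, mem_univ, true_and] at h
    simp only [mem_product, mem_powersetCard, subset_univ, true_and]
    rw [Finset.card_image_of_injective _ h.1, Finset.card_image_of_injective _ h.2.1]
    exact ⟨rfl, rfl⟩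

lemma Epos_Phi_of_le {N n i a b : ℕ} (hi : i ≤ b) (hba : b ≤ a) (hn : a + b = n) :
    Epos N n (Phi N n i a) :=
  Epos_Phi N n (n - (a + i)) i a (hi.trans hba) (by omega)

lemma Epos_of_cliques {n N : ℕ} (G : SimpleGraph (Fin n)) (p : Fin n → Prop)
    (hle' : Nat.card {v // ¬ p v} ≤ Nat.card {v // p v})
    (h1 : ∀ u v, p u → p v → u ≠ v → G.Adj u v)
    (h2 : ∀ u v, ¬ p u → ¬ p v → u ≠ v → G.Adj u v) :
    Epos N n (map (Int.castRingHom ℚ) (chromSym n N G)) := by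
  have hle : Fintype.card {v // ¬ p v} ≤ Fintype.card {v // p v} := by
    simpa only [Nat.card_eq_fintype_card] using hle'
  obtain ⟨g⟩ := Function.Embedding.nonempty_of_card_le hle
  have hn : Fintype.card {v // p v} + Fintype.card {v // ¬ p v} = n := by
    rw [Fintype.card_subtype_compl, Fintype.card_fin]
    have := Fintype.card_subtype_le p
    rw [Fintype.card_fin] at this
    omega
  have key := two_clique_sum (N := N) (fun (v : {v // ¬ p v}) (u : {v // p v}) => ¬ G.Adj u.1 v.1) g hn
  have hX : map (Int.castRingHom ℚ) (chromSym n N G) =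
      ∑ κ : ({v // p v} → Fin N) × ({v // ¬ p v} → Fin N),
      if (Function.Injective κ.1 ∧ Function.Injective κ.2 ∧
        ∀ (u : {v // p v}) (v : {v // ¬ p v}), κ.1 u = κ.2 v → ¬ G.Adj u.1 v.1) then
        (∏ u, X (κ.1 u)) * (∏ v, X (κ.2 v)) else (0 : MvPolynomial (Fin N) ℚ) := by
    unfold chromSym
    rw [map_sum]
    refine Fintype.sum_equiv (Equiv.piEquivPiSubtypeProd p (fun _ => Fin N)) _ _ ?_
    intro κ
    simp only [Equiv.piEquivPiSubtypeProd_apply]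
    have hiff : IsProper G κ ↔ (Function.Injective (fun u : {v // p v} => κ u) ∧
        Function.Injective (fun u : {v // ¬ p v} => κ u) ∧
        ∀ (u : {v // p v}) (v : {v // ¬ p v}), κ u = κ v → ¬ G.Adj u.1 v.1) := by
      constructor
      · intro h
        refine ⟨fun u v huv => ?_, fun u v huv => ?_, fun u v huv hadj => h _ _ hadj huv⟩
        · by_contra hne
          exact h _ _ (h1 u v u.2 v.2 fun h => hne (Subtype.ext h)) huv
        · by_contra hne
          exact h _ _ (h2 u v u.2 v.2 fun h => hne (Subtype.ext h)) huv
      · rintro ⟨ha, hb, hab⟩ u v hadj huv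
        by_cases hu : p u <;> by_cases hv : p v
        · exact hadj.ne (congrArg Subtype.val (@ha ⟨u, hu⟩ ⟨v, hv⟩ huv))
        · exact hab ⟨u, hu⟩ ⟨v, hv⟩ huv hadj
        · exact hab ⟨v, hv⟩ ⟨u, hu⟩ huv.symm hadj.symm
        · exact hadj.ne (congrArg Subtype.val (@hb ⟨u, hu⟩ ⟨v, hv⟩ huv))
    by_cases h : IsProper G κ
    · rw [if_pos h, if_pos (hiff.1 h), map_prod]
      simp only [map_X]
      exact (Fintype.prod_subtype_mul_prod_subtype p (fun i => (X (κ i) : MvPolynomial (Fin N) ℚ))).symm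
    · rw [if_neg h, if_neg fun h' => h (hiff.2 h'), map_zero]
  rw [hX]
  refine Eq.mp (congrArg (Epos N n) (key.symm.trans ?_)) ?_
  · congr!
  refine Epos.sum _ _ fun σ _ => Epos.smul ?_ _ (by positivity)
  exact Epos_Phi_of_le (card_le_univ _) hle hn

/-- a natural unit interval graph with independence number `2`
has `e`-positive chromatic symmetric function. -/
theorem stmt5 (n N : ℕ) (hN : n ≤ N) (G : SimpleGraph (Fin n)) (hG : IsNUIG G)
    (halpha : indepNum G = 2)
    (c : Nat.Partition n → ℤ)
    (hc : chromSym n N G = ∑ p : Nat.Partition n, C (c p) * eProd N ℤ p) :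
    ∀ p, 0 ≤ c p := by
  have hind : ∀ s : Finset (Fin n), IsIndepFinset G s → s.card ≤ 2 := by
    intro s hs
    rw [← halpha]
    refine le_csSup ⟨n, ?_⟩ ⟨s, hs, rfl⟩
    rintro k ⟨t, _, rfl⟩
    simpa using card_le_univ t
  let P : Fin n → Prop := fun v => ∃ u, u < v ∧ ¬ G.Adj u v
  have h1 : ∀ u v, P u → P v → u ≠ v → G.Adj u v := by
    have aux : ∀ u v, P u → u < v → G.Adj u v := by
      rintro u v ⟨w, hwu, hw⟩ huv
      by_contra hn
      have hwv : ¬ G.Adj w v := fun h => hw (hG w u v hwu huv h).1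
      have h3 := hind {w, u, v} (by
        intro i hi j hj
        simp only [mem_insert, mem_singleton] at hi hj
        rcases hi with rfl | rfl | rfl <;> rcases hj with rfl | rfl | rfl <;>
          first | exact G.irrefl | assumption | (rw [G.adj_comm]; assumption))
      rw [Finset.card_eq_three.2 ⟨w, u, v, hwu.ne, (hwu.trans huv).ne, huv.ne, rfl⟩] at h3
      omega
    intro u v hu hv huv
    rcases lt_or_gt_of_ne huv with h | h
    · exact aux u v hu h
    · exact (aux v u hv h).symm
  have h2 : ∀ u v, ¬ P u → ¬ P v → u ≠ v → G.Adj u v := by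
    intro u v hu hv huv
    by_contra hn
    rcases lt_or_gt_of_ne huv with h | h
    · exact hv ⟨u, h, hn⟩
    · exact hu ⟨v, h, fun h' => hn h'.symm⟩
  have hE : Epos N n (map (Int.castRingHom ℚ) (chromSym n N G)) := by
    rcases le_total (Nat.card {v // ¬ P v}) (Nat.card {v // P v}) with h | h
    · exact Epos_of_cliques G P h h1 h2
    · refine Epos_of_cliques G (fun v => ¬ P v) ?_ h2 ?_
      · simpa only [not_not] using h
      · simpa only [not_not] using h1
  obtain ⟨d, hd, hd'⟩ := hE
  have hmap : map (Int.castRingHom ℚ) (chromSym n N G) =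
      ∑ p : Nat.Partition n, C ((c p : ℚ)) * eProd N ℚ p := by
    rw [hc, map_sum]
    refine Finset.sum_congr rfl fun p _ => ?_
    rw [map_mul, map_C]
    congr 1
    unfold eProd
    rw [map_multiset_prod, Multiset.map_map]
    simp only [Function.comp_def, map_esymm]
  have heq := eProd_indep hN _ _ (hmap.symm.trans hd')
  intro p
  have := hd p
  rw [← congrFun heq p] at this
  exact_mod_cast this
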